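/- There is a constant C > 0 such that for all y with 0 < y ≤ 3^{−1/4}, |G₂(y) − G₂(0) + 3·2^{−2/3}·y^{2/3}| ≤ C·y^{10/3}; that is, G₂(y) = G₂(0) − 3·2^{−2/3} y^{2/3} + O(y^{10/3}) as y → 0⁺. -/

import Mathlib

open Real

/-- G₂(y) = ∫_y^{3^{−1/4}} t^{−1/3}·[(1 + √(1 − t⁸/432))^{1/3} + (1 − √(1 − t⁸/432))^{1/3}] dt. -/
noncomputable def G2 (y : ℝ) : ℝ :=
  ∫ t in y..(3:ℝ) ^ (-(1:ℝ)/4),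
    t ^ (-(1:ℝ)/3) * ((1 + Real.sqrt (1 - t ^ 8 / 432)) ^ ((1:ℝ)/3)
      + (1 - Real.sqrt (1 - t ^ 8 / 432)) ^ ((1:ℝ)/3))

/-- The sum of cube roots `(1 + √(1 - x))^{1/3} + (1 - √(1 - x))^{1/3}` differs from its value
`2^{1/3}` at `x = 0` by at most `x^{1/3}`. -/
theorem abs_add_cbrt_sub_two_cbrt_le {x : ℝ} (hx0 : 0 ≤ x) (hx1 : x ≤ 1) :
    |(1 + √(1 - x)) ^ ((1:ℝ)/3) + (1 - √(1 - x)) ^ ((1:ℝ)/3) - 2 ^ ((1:ℝ)/3)|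
      ≤ x ^ ((1:ℝ)/3) := by
  have hu0 : 0 ≤ √(1 - x) := Real.sqrt_nonneg _
  have hu1 : √(1 - x) ≤ 1 := Real.sqrt_le_one.mpr (by linarith)
  have hux : 1 - √(1 - x) ≤ x := by
    nlinarith [Real.sq_sqrt (show 0 ≤ 1 - x by linarith)]
  have hlow : (2:ℝ) ^ ((1:ℝ)/3)
      ≤ (1 + √(1 - x)) ^ ((1:ℝ)/3) + (1 - √(1 - x)) ^ ((1:ℝ)/3) := by
    have h := Real.rpow_add_le_add_rpow (p := (1:ℝ)/3) (a := 1 + √(1 - x))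
      (b := 1 - √(1 - x)) (by linarith) (by linarith) (by norm_num) (by norm_num)
    rwa [show 1 + √(1 - x) + (1 - √(1 - x)) = 2 by ring] at h
  have hup : (1 + √(1 - x)) ^ ((1:ℝ)/3) ≤ 2 ^ ((1:ℝ)/3) :=
    Real.rpow_le_rpow (by linarith) (by linarith) (by norm_num)
  have hsmall : (1 - √(1 - x)) ^ ((1:ℝ)/3) ≤ x ^ ((1:ℝ)/3) :=
    Real.rpow_le_rpow (by linarith) hux (by norm_num)
  rw [abs_of_nonneg (by linarith)]
  linarith

theorem intervalIntegrable_G2_integrand (a b : ℝ) :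
    IntervalIntegrable (fun t : ℝ => t ^ (-(1:ℝ)/3) *
      ((1 + √(1 - t ^ 8 / 432)) ^ ((1:ℝ)/3) + (1 - √(1 - t ^ 8 / 432)) ^ ((1:ℝ)/3)))
      MeasureTheory.volume a b := by
  refine (intervalIntegral.intervalIntegrable_rpow' (by norm_num)).mul_continuousOn ?_
  refine Continuous.continuousOn (.add ?_ ?_)
  all_goals exact Continuous.rpow_const (by fun_prop) fun _ => Or.inr (by norm_num)

theorem G2_expansion_at_zero :
    ∃ C > (0:ℝ), ∀ y : ℝ, 0 < y → y ≤ (3:ℝ) ^ (-(1:ℝ)/4) →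
      |G2 y - G2 0 + 3 * 2 ^ (-(2:ℝ)/3) * y ^ ((2:ℝ)/3)| ≤ C * y ^ ((10:ℝ)/3) := by
  refine ⟨3 / 10, by norm_num, fun y hy hy3 => ?_⟩
  have hy1 : y ≤ 1 :=
    hy3.trans (Real.rpow_le_one_of_one_le_of_nonpos (by norm_num) (by norm_num))
  have hpow : IntervalIntegrable (fun t : ℝ => t ^ (-(1:ℝ)/3) * 2 ^ ((1:ℝ)/3))
      MeasureTheory.volume 0 y :=
    (intervalIntegral.intervalIntegrable_rpow' (by norm_num)).mul_const _
  have hmain : ∫ t in (0:ℝ)..y, t ^ (-(1:ℝ)/3) * 2 ^ ((1:ℝ)/3)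
      = 3 * 2 ^ (-(2:ℝ)/3) * y ^ ((2:ℝ)/3) := by
    have h2 : (2:ℝ) ^ ((1:ℝ)/3) = 2 * 2 ^ (-(2:ℝ)/3) := by
      rw [← Real.rpow_one_add' (by norm_num) (by norm_num)]
      norm_num
    rw [intervalIntegral.integral_mul_const, integral_rpow (Or.inl (by norm_num)), h2,
      show -(1:ℝ)/3 + 1 = 2/3 by norm_num, Real.zero_rpow (by norm_num)]
    ring
  have hbound : ∫ t in (0:ℝ)..y, t ^ ((7:ℝ)/3) = 3 / 10 * y ^ ((10:ℝ)/3) := by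
    rw [integral_rpow (Or.inl (by norm_num)), show (7:ℝ)/3 + 1 = 10/3 by norm_num,
      Real.zero_rpow (by norm_num)]
    ring
  rw [G2, G2, ← intervalIntegral.integral_add_adjacent_intervals
    (intervalIntegrable_G2_integrand 0 y) (intervalIntegrable_G2_integrand y _),
    sub_add_cancel_right, neg_add_eq_sub, abs_sub_comm, ← hmain,
    ← intervalIntegral.integral_sub (intervalIntegrable_G2_integrand 0 y) hpow,
    ← hbound, ← Real.norm_eq_abs]
  refine intervalIntegral.norm_integral_le_of_norm_le hy.le (.of_forall fun t ht => ?_)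
    (intervalIntegral.intervalIntegrable_rpow' (by norm_num))
  have ht0 : 0 < t := ht.1
  have ht8 : t ^ 8 ≤ 1 := pow_le_one₀ ht0.le (ht.2.trans hy1)
  rw [← mul_sub, norm_mul, Real.norm_of_nonneg (by positivity), Real.norm_eq_abs]
  calc t ^ (-(1:ℝ)/3) * _ ≤ t ^ (-(1:ℝ)/3) * (t ^ 8 / 432) ^ ((1:ℝ)/3) := by
        gcongr
        exact abs_add_cbrt_sub_two_cbrt_le (by positivity) (by linarith)
    _ ≤ t ^ (-(1:ℝ)/3) * (t ^ 8) ^ ((1:ℝ)/3) := by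
        gcongr
        exact div_le_self (by positivity) (by norm_num)
    _ = t ^ ((7:ℝ)/3) := by
        rw [← Real.rpow_natCast, ← Real.rpow_mul ht0.le, ← Real.rpow_add ht0]
        norm_num
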